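/- Given a context-sensitive ω-grammar G = (N, T, P, S, 𝓕), there can be constructed a context-sensitive ω-grammar G' = (N', T, P', S, 𝓗) all of whose productions are of the forms α → β with α, β ∈ N⁺ and |α| ≤ |β|, or A → a with A ∈ N and a ∈ T, such that L_{σ,ρ,π}(G) = L_{σ,ρ,π}(G') for every σ ∈ {ran, inf}, ρ ∈ {⊓, ⊆, =}, and π ∈ {l, nl}. -/

import Mathlib

namespace OmegaFormal

/-- σ component of an acceptance mode: `ran` (occurs at least once)
or `inf` (occurs infinitely often). -/
inductive AccSigma | ran | inf
deriving DecidableEq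

/-- ρ component of an acceptance mode: `cap` (nonempty intersection, ⊓),
`sub` (⊆) or `eq` (=). -/
inductive AccRho | cap | sub | eq
deriving DecidableEq

/-- derivation mode: leftmost (`l`) or normal (`nl`). -/
inductive DerivMode | l | nl
deriving DecidableEq

/-- `sigmaSet σ f` is ran(f) resp. inf(f). -/
def sigmaSet {Q : Type _} : AccSigma → (ℕ → Q) → Set Q
  | .ran, f => Set.range f
  | .inf, f => {q | ∀ n : ℕ, ∃ m : ℕ, n ≤ m ∧ f m = q}

/-- the binary relation denoted by ρ. -/
def rhoRel {Q : Type _} : AccRho → Set Q → Set Q → Prop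
  | .cap, A, B => (A ∩ B).Nonempty
  | .sub, A, B => A ⊆ B
  | .eq,  A, B => A = B

/-- f is (σ,ρ)-accepting w.r.t. the set 𝓕 of designated sets. -/
def IsAccepting {Q : Type _} (σ : AccSigma) (ρ : AccRho) (𝓕 : Set (Set Q)) (f : ℕ → Q) : Prop :=
  ∃ F ∈ 𝓕, rhoRel ρ (sigmaSet σ f) F

/-- the finite word `l` coincides with the prefix of the ω-word `u`. -/
def MatchesPrefix {T : Type _} (l : List T) (u : ℕ → T) : Prop :=
  ∀ (k : ℕ) (h : k < l.length), l.get ⟨k, h⟩ = u k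

/-- the maximal terminal prefix of a sentential form. -/
def termPrefix {N T : Type _} : List (N ⊕ T) → List T
  | [] => []
  | (Sum.inl _) :: _ => []
  | (Sum.inr a) :: l => a :: termPrefix l

/-- A phrase structure ω-grammar `G = (N, T, P, S, 𝓕)`:
`N` nonterminals, `T` terminals, `P` named productions `p : lhs p → rhs p`
with `lhs p ∈ N⁺`, `rhs p ∈ (N ∪ T)*`, start symbol, and
production repetition sets `acc ⊆ 2^P`. -/
structure OmegaPSG (T : Type) where
  N : Type
  [fintypeN : Fintype N]
  P : Type
  [fintypeP : Fintype P]
  lhs : P → List N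
  lhs_ne : ∀ p : P, lhs p ≠ []
  rhs : P → List (N ⊕ T)
  start : N
  acc : Set (Set P)

namespace OmegaPSG

variable {T : Type} (G : OmegaPSG T)

/-- one (normal) rewriting step using production p. -/
def Step (p : G.P) (x y : List (G.N ⊕ T)) : Prop :=
  ∃ u v : List (G.N ⊕ T),
    x = u ++ (G.lhs p).map Sum.inl ++ v ∧ y = u ++ G.rhs p ++ v

/-- one leftmost rewriting step: the rewritten occurrence starts at the
leftmost nonterminal, i.e. everything to its left is terminal. -/
def LStep (p : G.P) (x y : List (G.N ⊕ T)) : Prop :=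
  ∃ u v : List (G.N ⊕ T), (∀ s ∈ u, ∃ a : T, s = Sum.inr a) ∧
    x = u ++ (G.lhs p).map Sum.inl ++ v ∧ y = u ++ G.rhs p ++ v

def StepOf : DerivMode → G.P → List (G.N ⊕ T) → List (G.N ⊕ T) → Prop
  | .l => G.LStep
  | .nl => G.Step

/-- `L_{σ,ρ,π}(G)`: ω-words admitting an infinite π-derivation from S whose
growing terminal prefixes spell the word and whose production sequence is
(σ,ρ)-accepting w.r.t. `G.acc`. -/
def Lang (σ : AccSigma) (ρ : AccRho) (π : DerivMode) : Set (ℕ → T) :=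
  {u | ∃ (s : ℕ → List (G.N ⊕ T)) (d : ℕ → G.P),
    s 0 = [Sum.inl G.start] ∧
    (∀ i : ℕ, G.StepOf π (d i) (s i) (s (i + 1))) ∧
    (∀ n : ℕ, ∃ i : ℕ, n ≤ (termPrefix (s i)).length) ∧
    (∀ i : ℕ, MatchesPrefix (termPrefix (s i)) u) ∧
    IsAccepting σ ρ G.acc d}

/-- context-free: every left-hand side is a single nonterminal. -/
def IsCFG : Prop := ∀ p : G.P, (G.lhs p).length = 1

/-- context-sensitive (monotonic): `|β| ≥ |α|` for every production. -/
def IsCSG : Prop := ∀ p : G.P, (G.lhs p).length ≤ (G.rhs p).length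

/-- right linear: productions of the form `A → uB` or `A → u`, `u ∈ T*`. -/
def IsRLG : Prop :=
  ∀ p : G.P, (G.lhs p).length = 1 ∧
    ∃ (w : List T) (B : Option G.N),
      G.rhs p = w.map Sum.inr ++ B.toList.map Sum.inl

/-- `G` is a grammar with `$`-boundary (PSG version): with `$` = `dollar`,
`S` = `S'`, every production has one of the forms
(1) α → β, α,β ∈ N⁺ (N = nonterminals other than `$`, `S`),
(2) S → $α, α ∈ N⁺, (3) $A → a$, (4) A → ε. -/
def HasDollarBoundary (dollar S' : G.N) : Prop :=
  dollar ≠ S' ∧ G.start = S' ∧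
  ∀ p : G.P,
    ((dollar ∉ G.lhs p ∧ S' ∉ G.lhs p) ∧
      ∃ β : List G.N, β ≠ [] ∧ dollar ∉ β ∧ S' ∉ β ∧ G.rhs p = β.map Sum.inl) ∨
    (G.lhs p = [S'] ∧ ∃ α : List G.N, α ≠ [] ∧ dollar ∉ α ∧ S' ∉ α ∧
      G.rhs p = Sum.inl dollar :: α.map Sum.inl) ∨
    (∃ A : G.N, A ≠ dollar ∧ A ≠ S' ∧ G.lhs p = [dollar, A] ∧
      ∃ a : T, G.rhs p = [Sum.inr a, Sum.inl dollar]) ∨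
    (∃ A : G.N, A ≠ dollar ∧ A ≠ S' ∧ G.lhs p = [A] ∧ G.rhs p = [])

/-- `G` is a grammar with `$`-boundary (CSG version): forms (1)-(3) only,
with `|α| ≤ |β|` in form (1). -/
def HasDollarBoundaryCSG (dollar S' : G.N) : Prop :=
  dollar ≠ S' ∧ G.start = S' ∧
  ∀ p : G.P,
    ((dollar ∉ G.lhs p ∧ S' ∉ G.lhs p) ∧
      ∃ β : List G.N, β ≠ [] ∧ dollar ∉ β ∧ S' ∉ β ∧ (G.lhs p).length ≤ β.length ∧
        G.rhs p = β.map Sum.inl) ∨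
    (G.lhs p = [S'] ∧ ∃ α : List G.N, α ≠ [] ∧ dollar ∉ α ∧ S' ∉ α ∧
      G.rhs p = Sum.inl dollar :: α.map Sum.inl) ∨
    (∃ A : G.N, A ≠ dollar ∧ A ≠ S' ∧ G.lhs p = [dollar, A] ∧
      ∃ a : T, G.rhs p = [Sum.inr a, Sum.inl dollar])

end OmegaPSG

/-- `𝓛_{σ,ρ,π}(X)` for the family `X` of ω-grammars over `T` satisfying `C`. -/
def GLang (T : Type) (C : OmegaPSG T → Prop) (σ : AccSigma) (ρ : AccRho) (π : DerivMode) :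
    Set (Set (ℕ → T)) :=
  {L | ∃ G : OmegaPSG T, C G ∧ L = G.Lang σ ρ π}

/-- number of non-ε labels among `b 0, …, b (i-1)`. -/
def someCount {A : Type _} (b : ℕ → Option A) (i : ℕ) : ℕ :=
  ((Finset.range i).filter fun j => (b j).isSome = true).card

/-- the (ε-allowing) label sequence `b` concatenates to the ω-word `u`. -/
def Spells {A : Type _} (b : ℕ → Option A) (u : ℕ → A) : Prop :=
  (∀ n : ℕ, ∃ i : ℕ, n ≤ someCount b i) ∧
  ∀ i : ℕ, ∀ a : A, b i = some a → a = u (someCount b i)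

/-- A finite state ω-automaton `(Q, Σ, δ, q₀, 𝓕)`. -/
structure OmegaFSA (Sig : Type) where
  Q : Type
  [fintypeQ : Fintype Q]
  init : Q
  trans : Q → Option Sig → Q → Prop
  acc : Set (Set Q)

/-- `L_{σ,ρ}(A)` for a finite state ω-automaton. -/
def OmegaFSA.Lang {Sig : Type} (A : OmegaFSA Sig) (σ : AccSigma) (ρ : AccRho) :
    Set (ℕ → Sig) :=
  {u | ∃ (r : ℕ → A.Q) (b : ℕ → Option Sig),
    r 0 = A.init ∧ (∀ i : ℕ, A.trans (r i) (b i) (r (i + 1))) ∧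
    Spells b u ∧ IsAccepting σ ρ A.acc r}

/-- `𝓛_{σ,ρ}(ω-FSA)`. -/
def FSALang (Sig : Type) (σ : AccSigma) (ρ : AccRho) : Set (Set (ℕ → Sig)) :=
  {L | ∃ A : OmegaFSA Sig, L = A.Lang σ ρ}

/-- A pushdown ω-automaton `(Q, Σ, Γ, δ, q₀, Z₀, 𝓕)`. -/
structure OmegaPDA (Sig : Type) where
  Q : Type
  [fintypeQ : Fintype Q]
  Γ : Type
  [fintypeΓ : Fintype Γ]
  init : Q
  Z0 : Γ
  trans : Q → Option Sig → Γ → Q → List Γ → Prop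
  acc : Set (Set Q)

/-- `L_{σ,ρ}(D)` for a pushdown ω-automaton. -/
def OmegaPDA.Lang {Sig : Type} (D : OmegaPDA Sig) (σ : AccSigma) (ρ : AccRho) :
    Set (ℕ → Sig) :=
  {u | ∃ (q : ℕ → D.Q) (st : ℕ → List D.Γ) (b : ℕ → Option Sig),
    q 0 = D.init ∧ st 0 = [D.Z0] ∧
    (∀ i : ℕ, ∃ (Z : D.Γ) (γ rest : List D.Γ),
      st i = Z :: rest ∧ D.trans (q i) (b i) Z (q (i + 1)) γ ∧ st (i + 1) = γ ++ rest) ∧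
    Spells b u ∧ IsAccepting σ ρ D.acc q}

/-- `𝓛_{σ,ρ}(ω-PDA)`. -/
def PDALang (Sig : Type) (σ : AccSigma) (ρ : AccRho) : Set (Set (ℕ → Sig)) :=
  {L | ∃ D : OmegaPDA Sig, L = D.Lang σ ρ}

/-- tape head moves. -/
inductive Move | L | R | S
deriving DecidableEq

def moveHead : Move → ℕ → ℕ
  | .L, n => n - 1
  | .R, n => n + 1
  | .S, n => n

/-- A single-tape Turing ω-machine `(Q, Σ, Γ, δ, q₀, 𝓕)` (Σ ⊆ Γ via `embed`). -/
structure OmegaTM (Sig : Type) where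
  Q : Type
  [fintypeQ : Fintype Q]
  Γ : Type
  [fintypeΓ : Fintype Γ]
  embed : Sig → Γ
  embed_inj : Function.Injective embed
  init : Q
  trans : Q → Γ → Q → Γ → Move → Prop
  acc : Set (Set Q)

/-- `L_{σ,ρ}(M)`: ω-words admitting a complete non-oscillating run whose state
sequence is (σ,ρ)-accepting. -/
def OmegaTM.Lang {Sig : Type} (M : OmegaTM Sig) (σ : AccSigma) (ρ : AccRho) :
    Set (ℕ → Sig) :=
  {u | ∃ (q : ℕ → M.Q) (tape : ℕ → ℕ → M.Γ) (pos : ℕ → ℕ),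
    q 0 = M.init ∧ (∀ n : ℕ, tape 0 n = M.embed (u n)) ∧ pos 0 = 0 ∧
    (∀ i : ℕ, ∃ (g : M.Γ) (m : Move),
      M.trans (q i) (tape i (pos i)) (q (i + 1)) g m ∧
      tape (i + 1) = Function.update (tape i) (pos i) g ∧
      pos (i + 1) = moveHead m (pos i)) ∧
    (∀ n : ℕ, ∃ i : ℕ, n ≤ pos i) ∧
    (∀ n : ℕ, ∃ i0 : ℕ, ∀ i : ℕ, i0 ≤ i → pos i ≠ n) ∧
    IsAccepting σ ρ M.acc q}

/-- `𝓛_{σ,ρ}(ω-TM)`. -/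
def TMLang (Sig : Type) (σ : AccSigma) (ρ : AccRho) : Set (Set (ℕ → Sig)) :=
  {L | ∃ M : OmegaTM Sig, L = M.Lang σ ρ}

/-- An m-tape Turing ω-machine. -/
structure OmegaMTM (m : ℕ) (Sig : Type) where
  Q : Type
  [fintypeQ : Fintype Q]
  Γ : Type
  [fintypeΓ : Fintype Γ]
  embed : Sig → Γ
  embed_inj : Function.Injective embed
  blank : Γ
  init : Q
  trans : Q → (Fin m → Γ) → Q → (Fin m → Γ) → (Fin m → Move) → Prop
  acc : Set (Set Q)

/-- `L_{σ,ρ}(M)` for an m-tape Turing ω-machine (`hm : 0 < m`; the input is on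
the first tape, the other tapes are initially blank; the run must be complete
and non-oscillating on the first tape). -/
def OmegaMTM.Lang {m : ℕ} {Sig : Type} (M : OmegaMTM m Sig) (hm : 0 < m)
    (σ : AccSigma) (ρ : AccRho) : Set (ℕ → Sig) :=
  {u | ∃ (q : ℕ → M.Q) (tape : ℕ → Fin m → ℕ → M.Γ) (pos : ℕ → Fin m → ℕ),
    q 0 = M.init ∧
    (∀ n : ℕ, tape 0 ⟨0, hm⟩ n = M.embed (u n)) ∧
    (∀ j : Fin m, j ≠ ⟨0, hm⟩ → ∀ n : ℕ, tape 0 j n = M.blank) ∧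
    (∀ j : Fin m, pos 0 j = 0) ∧
    (∀ i : ℕ, ∃ (g : Fin m → M.Γ) (mv : Fin m → Move),
      M.trans (q i) (fun j => tape i j (pos i j)) (q (i + 1)) g mv ∧
      (∀ j : Fin m, tape (i + 1) j = Function.update (tape i j) (pos i j) (g j)) ∧
      (∀ j : Fin m, pos (i + 1) j = moveHead (mv j) (pos i j))) ∧
    (∀ n : ℕ, ∃ i : ℕ, n ≤ pos i ⟨0, hm⟩) ∧
    (∀ n : ℕ, ∃ i0 : ℕ, ∀ i : ℕ, i0 ≤ i → pos i ⟨0, hm⟩ ≠ n) ∧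
    IsAccepting σ ρ M.acc q}

/-- `𝓛_{σ,ρ}(m-ω-TM)`. -/
def MTMLang (Sig : Type) (m : ℕ) (hm : 0 < m) (σ : AccSigma) (ρ : AccRho) :
    Set (Set (ℕ → Sig)) :=
  {L | ∃ M : OmegaMTM m Sig, L = M.Lang hm σ ρ}

/-- the ω-language `{aⁿbⁿ | n ≥ 1}^ω` over the alphabet `Bool`
(`false` = a, `true` = b). -/
def abLang : Set (ℕ → Bool) :=
  {u | ∃ n : ℕ → ℕ, (∀ i : ℕ, 1 ≤ n i) ∧
    ∀ i k : ℕ, k < 2 * n i →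
      u ((∑ j ∈ Finset.range i, 2 * n j) + k) = decide (n i ≤ k)}

end OmegaFormal
open OmegaFormal

namespace OmegaFormal

section Sequences

theorem exists_forall_ge_eq_of_eventually_antitone {c : ℕ → ℕ} {n : ℕ}
    (h : ∀ i, n ≤ i → c (i + 1) ≤ c i) : ∃ m, ∀ i, m ≤ i → c (i + 1) = c i := by
  classical
  have hex : ∃ v, ∃ i, n ≤ i ∧ c i = v := ⟨_, n, le_rfl, rfl⟩
  obtain ⟨m, hm, hv⟩ := Nat.find_spec hex
  have key : ∀ i, m ≤ i → c i = Nat.find hex := by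
    intro i hi
    induction i, hi using Nat.le_induction with
    | base => exact hv
    | succ i hi ih =>
      have h1 := h i (hm.trans hi)
      have h2 : Nat.find hex ≤ c (i + 1) := Nat.find_min' hex ⟨i + 1, by omega, rfl⟩
      omega
  exact ⟨m, fun i hi => by rw [key i hi, key (i + 1) (by omega)]⟩

variable {P R : Type _} {e : ℕ → P ⊕ R} {κ : ℕ → ℕ}

/-- `κ i` is the number of left entries among `e 0, …, e (i - 1)`. -/
def CountsLeft (e : ℕ → P ⊕ R) (κ : ℕ → ℕ) : Prop :=
  κ 0 = 0 ∧ ∀ i, κ (i + 1) = κ i + if (e i).isLeft then 1 else 0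

theorem CountsLeft.monotone (h : CountsLeft e κ) : Monotone κ :=
  monotone_nat_of_le_succ fun i => by rw [h.2 i]; omega

theorem CountsLeft.succ_of_isLeft (h : CountsLeft e κ) {i : ℕ} (hi : (e i).isLeft) :
    κ (i + 1) = κ i + 1 := by
  simp [h.2 i, hi]

theorem CountsLeft.exists_isLeft_eq (h : CountsLeft e κ)
    (hinf : ∀ n, ∃ i, n ≤ i ∧ (e i).isLeft) (m : ℕ) : ∃ i, κ i = m ∧ (e i).isLeft := by
  classical
  have advance : ∀ i, ∃ j, κ j = κ i ∧ (e j).isLeft := by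
    intro i
    have hex := hinf i
    obtain ⟨hle, hleft⟩ := Nat.find_spec hex
    refine ⟨Nat.find hex, ?_, hleft⟩
    have key : ∀ j, i ≤ j → j ≤ Nat.find hex → κ j = κ i := by
      intro j hj
      induction j, hj using Nat.le_induction with
      | base => simp
      | succ j hj ih =>
        intro hlt
        have hnot : ¬ (e j).isLeft := fun hl => Nat.find_min hex hlt ⟨hj, hl⟩
        rw [h.2 j, ih (by omega), if_neg hnot, Nat.add_zero]
    exact key _ hle le_rfl
  induction m with
  | zero => simpa [h.1] using advance 0
  | succ m ih =>
    obtain ⟨i, hi, hl⟩ := ih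
    have := advance (i + 1)
    rwa [h.succ_of_isLeft hl, hi] at this

theorem CountsLeft.eq_of_isLeft (h : CountsLeft e κ) {i j : ℕ} (hi : (e i).isLeft)
    (hj : (e j).isLeft) (hij : κ i = κ j) : i = j := by
  have h1 := h.succ_of_isLeft hi
  have h2 := h.succ_of_isLeft hj
  rcases lt_trichotomy i j with hlt | rfl | hlt
  · have := h.monotone (Nat.succ_le_of_lt hlt)
    simp only [Nat.succ_eq_add_one] at this
    omega
  · rfl
  · have := h.monotone (Nat.succ_le_of_lt hlt)
    simp only [Nat.succ_eq_add_one] at this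
    omega

/-- If `d` is the subsequence of left entries of `e`, then ran and inf of `d` are the left parts
of those of `e`. -/
theorem CountsLeft.sigmaSet_eq_preimage (h : CountsLeft e κ)
    (hinf : ∀ n, ∃ i, n ≤ i ∧ (e i).isLeft) {d : ℕ → P}
    (hd : ∀ i p, e i = Sum.inl p → d (κ i) = p) (σ : AccSigma) :
    sigmaSet σ d = Sum.inl ⁻¹' sigmaSet σ e := by
  have hit : ∀ m, ∃ i, κ i = m ∧ e i = Sum.inl (d m) := by
    intro m
    obtain ⟨i, rfl, hl⟩ := h.exists_isLeft_eq hinf m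
    obtain ⟨p, hp⟩ := Sum.isLeft_iff.1 hl
    exact ⟨i, rfl, by rw [hp, hd i p hp]⟩
  ext p
  cases σ with
  | ran =>
    constructor
    · rintro ⟨m, rfl⟩
      obtain ⟨i, -, hi⟩ := hit m
      exact ⟨i, hi⟩
    · rintro ⟨i, hi⟩
      exact ⟨κ i, hd i p hi⟩
  | inf =>
    constructor
    · intro hp n
      obtain ⟨m, hm, rfl⟩ := hp (κ n)
      obtain ⟨i, rfl, hi⟩ := hit m
      refine ⟨i, ?_, hi⟩
      by_contra hlt
      have h1 := h.succ_of_isLeft (i := i) (by simp [hi])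
      have h2 : κ (i + 1) ≤ κ n := h.monotone (by omega)
      omega
    · intro hp n
      obtain ⟨i, rfl, -⟩ := hit n
      obtain ⟨j, hj, he⟩ := hp i
      exact ⟨κ j, h.monotone hj, hd j p he⟩

end Sequences

section TermPrefix

variable {N T : Type _}

theorem termPrefix_map_inr_append (w : List T) (x : List (N ⊕ T)) :
    termPrefix (w.map Sum.inr ++ x) = w ++ termPrefix x := by
  induction w with
  | nil => rfl
  | cons a w ih => simp [termPrefix, ih]

theorem eq_termPrefix_append (x : List (N ⊕ T)) :
    ∃ r, x = (termPrefix x).map Sum.inr ++ r ∧ termPrefix r = [] := by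
  induction x with
  | nil => exact ⟨[], rfl, rfl⟩
  | cons a x ih =>
    cases a with
    | inl A => exact ⟨Sum.inl A :: x, rfl, rfl⟩
    | inr a =>
      obtain ⟨r, hr, h⟩ := ih
      exact ⟨r, by simpa [termPrefix] using hr, h⟩

theorem exists_map_inr_eq {u : List (N ⊕ T)} (h : ∀ s ∈ u, ∃ a : T, s = Sum.inr a) :
    ∃ w : List T, u = w.map Sum.inr := by
  induction u with
  | nil => exact ⟨[], rfl⟩
  | cons s u ih =>
    obtain ⟨a, rfl⟩ := h s (by simp)
    obtain ⟨w, rfl⟩ := ih fun s hs => h s (by simp [hs])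
    exact ⟨a :: w, rfl⟩

theorem termPrefix_prefix_append (x y : List (N ⊕ T)) : termPrefix x <+: termPrefix (x ++ y) := by
  obtain ⟨r, hr, -⟩ := eq_termPrefix_append x
  conv_rhs => rw [hr]
  rw [List.append_assoc, termPrefix_map_inr_append]
  exact List.prefix_append _ _

theorem termPrefix_append_inl (u v : List (N ⊕ T)) (A : N) :
    termPrefix (u ++ Sum.inl A :: v) = termPrefix u := by
  induction u with
  | nil => rfl
  | cons s u ih => cases s <;> simp [termPrefix, ih]

theorem MatchesPrefix.of_prefix {l l' : List T} {u : ℕ → T} (h : MatchesPrefix l' u)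
    (hl : l <+: l') : MatchesPrefix l u := by
  obtain ⟨t, rfl⟩ := hl
  intro k hk
  have := h k (by simp; omega)
  simpa [List.getElem_append_left hk] using this

end TermPrefix

namespace OmegaPSG

variable {T : Type} (G : OmegaPSG T)

theorem stepOf_iff {π : DerivMode} {p : G.P} {x y : List (G.N ⊕ T)} :
    G.StepOf π p x y ↔ ∃ u v : List (G.N ⊕ T),
      (π = .l → ∀ s ∈ u, ∃ a : T, s = Sum.inr a) ∧
        x = u ++ (G.lhs p).map Sum.inl ++ v ∧ y = u ++ G.rhs p ++ v := by
  cases π <;> simp [StepOf, LStep, Step]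

theorem StepOf.termPrefix_prefix {G : OmegaPSG T} {π : DerivMode} {p : G.P}
    {x y : List (G.N ⊕ T)} (h : G.StepOf π p x y) : termPrefix x <+: termPrefix y := by
  obtain ⟨u, v, -, rfl, rfl⟩ := G.stepOf_iff.1 h
  obtain ⟨A, l, hA⟩ := List.exists_cons_of_ne_nil (G.lhs_ne p)
  rw [hA]
  simp only [List.map_cons, List.append_assoc, List.cons_append, termPrefix_append_inl]
  exact termPrefix_prefix_append _ _

/-- Replace every terminal `a` in the right-hand side of `p` by the nonterminal `(p, a)`, and add
the productions `(p, a) → a`. Recording `p` keeps the acceptance of a production sequence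
independent of the added productions. -/
abbrev normalForm [Fintype T] : OmegaPSG T :=
  letI := G.fintypeN
  letI := G.fintypeP
  { N := G.N ⊕ (G.P × T)
    P := G.P ⊕ (G.P × T)
    lhs := Sum.elim (fun p => (G.lhs p).map Sum.inl) fun q => [Sum.inr q]
    lhs_ne := by rintro (p | q) <;> simp [G.lhs_ne]
    rhs := Sum.elim
      (fun p => (G.rhs p).map fun s => Sum.inl (Sum.map id (fun a => (p, a)) s))
      fun q => [Sum.inr q.2]
    start := Sum.inl G.start
    acc := {H | Sum.inl ⁻¹' H ∈ G.acc ∧ ∀ q, Sum.inr q ∈ H → Sum.inl q.1 ∈ H} }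

/-- The symbol of `G` represented by a symbol of `G.normalForm`. -/
def erase : (G.N ⊕ (G.P × T)) ⊕ T → G.N ⊕ T :=
  Sum.elim (Sum.map id Prod.snd) Sum.inr

theorem map_erase_map_inr (w : List T) :
    (w.map Sum.inr).map G.erase = w.map Sum.inr := by
  simp [erase]

theorem map_erase_map_inl (l : List G.N) :
    ((l.map Sum.inl).map Sum.inl).map G.erase = l.map Sum.inl := by
  simp [erase]

theorem eq_of_map_erase_eq_map_inl {x : List ((G.N ⊕ (G.P × T)) ⊕ T)} {l : List G.N}
    (h : x.map G.erase = l.map Sum.inl) : x = (l.map Sum.inl).map Sum.inl := by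
  induction l generalizing x with
  | nil => simpa using h
  | cons A l ih =>
    obtain ⟨s, x, rfl, hs, hx⟩ := List.map_eq_cons_iff.1 h
    rw [ih hx]
    rcases s with (B | q) | a <;> simp_all [erase]

theorem termPrefix_prefix_map_erase (x : List ((G.N ⊕ (G.P × T)) ⊕ T)) :
    termPrefix x <+: termPrefix (x.map G.erase) := by
  obtain ⟨r, hr, -⟩ := eq_termPrefix_append x
  conv_rhs => rw [hr]
  rw [List.map_append, map_erase_map_inr, termPrefix_map_inr_append]
  exact List.prefix_append _ _

variable [Fintype T]

theorem isCSG_normalForm (hG : G.IsCSG) : G.normalForm.IsCSG := by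
  rintro (p | q)
  · simpa [normalForm] using hG p
  · simp [normalForm]

theorem normalForm_form (hG : G.IsCSG) (p : G.normalForm.P) :
    (∃ β : List G.normalForm.N, β ≠ [] ∧ (G.normalForm.lhs p).length ≤ β.length ∧
      G.normalForm.rhs p = β.map Sum.inl) ∨
    ((G.normalForm.lhs p).length = 1 ∧ ∃ a : T, G.normalForm.rhs p = [Sum.inr a]) := by
  rcases p with p | q
  · left
    have hlen := hG p
    have hpos := List.length_pos_iff.2 (G.lhs_ne p)
    refine ⟨(G.rhs p).map (Sum.map id fun a => (p, a)), ?_, ?_, ?_⟩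
    · rw [← List.length_pos_iff, List.length_map]
      omega
    · simpa [normalForm] using hlen
    · simp [normalForm]
  · right
    exact ⟨rfl, q.2, rfl⟩

theorem map_erase_rhs (p : G.P) :
    (G.normalForm.rhs (Sum.inl p)).map G.erase = G.rhs p := by
  simp only [Sum.elim_inl, List.map_map]
  conv_rhs => rw [← List.map_id (G.rhs p)]
  refine List.map_congr_left fun s _ => ?_
  cases s <;> rfl

variable {G} {π : DerivMode}

theorem StepOf.map_erase_of_inl {p : G.P} {x y : List (G.normalForm.N ⊕ T)}
    (h : G.normalForm.StepOf π (Sum.inl p) x y) :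
    G.StepOf π p (x.map G.erase) (y.map G.erase) := by
  obtain ⟨u, v, hu, rfl, rfl⟩ := G.normalForm.stepOf_iff.1 h
  refine G.stepOf_iff.2 ⟨u.map G.erase, v.map G.erase, fun hπ s hs => ?_, ?_, ?_⟩
  · obtain ⟨t, ht, rfl⟩ := List.mem_map.1 hs
    obtain ⟨a, rfl⟩ := hu hπ t ht
    exact ⟨a, rfl⟩
  · rw [List.map_append, List.map_append]
    congr 2
    exact G.map_erase_map_inl _
  · rw [List.map_append, List.map_append, map_erase_rhs]

theorem StepOf.map_erase_of_inr {q : G.P × T} {x y : List (G.normalForm.N ⊕ T)}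
    (h : G.normalForm.StepOf π (Sum.inr q) x y) : y.map G.erase = x.map G.erase := by
  obtain ⟨u, v, -, rfl, rfl⟩ := G.normalForm.stepOf_iff.1 h
  rw [List.map_append, List.map_append, List.map_append, List.map_append]
  rfl

theorem StepOf.exists_lift {p : G.P} {x : List (G.normalForm.N ⊕ T)} {y : List (G.N ⊕ T)}
    (h : G.StepOf π p (x.map G.erase) y)
    (hx : termPrefix x = termPrefix (x.map G.erase)) :
    ∃ y', G.normalForm.StepOf π (Sum.inl p) x y' ∧ y'.map G.erase = y := by
  obtain ⟨u, v, hu, hxe, rfl⟩ := G.stepOf_iff.1 h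
  have split : ∃ u' r : List (G.normalForm.N ⊕ T), x = u' ++ r ∧ u'.map G.erase = u ∧
      r.map G.erase = (G.lhs p).map Sum.inl ++ v ∧
      (π = .l → ∀ s ∈ u', ∃ a : T, s = Sum.inr a) := by
    by_cases hπ : π = .l
    · obtain ⟨w, rfl⟩ := exists_map_inr_eq (hu hπ)
      obtain ⟨A, l, hA⟩ := List.exists_cons_of_ne_nil (G.lhs_ne p)
      obtain ⟨r, hr, -⟩ := eq_termPrefix_append x
      have hw : termPrefix x = w := by
        rw [hx, hxe, hA, List.append_assoc, termPrefix_map_inr_append]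
        simp [termPrefix]
      rw [hw] at hr
      refine ⟨w.map Sum.inr, r, hr, G.map_erase_map_inr w, ?_, fun _ s hs => ?_⟩
      · rw [hr, List.map_append, List.append_assoc] at hxe
        rw [G.map_erase_map_inr] at hxe
        exact List.append_cancel_left hxe
      · obtain ⟨a, -, rfl⟩ := List.mem_map.1 hs
        exact ⟨a, rfl⟩
    · rw [List.append_assoc] at hxe
      obtain ⟨u', r, rfl, hu', hr⟩ := List.map_eq_append_iff.1 hxe
      exact ⟨u', r, rfl, hu', hr, fun h => absurd h hπ⟩
  obtain ⟨u', r, rfl, rfl, hr, hterm⟩ := split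
  obtain ⟨m, v', rfl, hm, rfl⟩ := List.map_eq_append_iff.1 hr
  obtain rfl := G.eq_of_map_erase_eq_map_inl hm
  refine ⟨u' ++ G.normalForm.rhs (Sum.inl p) ++ v', ?_, ?_⟩
  · exact G.normalForm.stepOf_iff.2 ⟨u', v', hterm, (List.append_assoc _ _ _).symm, rfl⟩
  · rw [List.map_append, List.map_append, map_erase_rhs]

theorem exists_stepOf_inr {x : List (G.normalForm.N ⊕ T)}
    (hx : termPrefix x ≠ termPrefix (x.map G.erase)) (π : DerivMode) :
    ∃ q y, G.normalForm.StepOf π (Sum.inr q) x y := by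
  obtain ⟨r, hr, hr0⟩ := eq_termPrefix_append x
  have hne : termPrefix (r.map G.erase) ≠ [] := by
    intro h0
    apply hx
    conv_rhs => rw [hr]
    rw [List.map_append]
    rw [G.map_erase_map_inr]
    rw [termPrefix_map_inr_append, h0, List.append_nil]
  rcases r with _ | ⟨(A | q) | a, r⟩
  · exact absurd rfl hne
  · exact absurd rfl hne
  · refine ⟨q, _, G.normalForm.stepOf_iff.2
      ⟨(termPrefix x).map Sum.inr, r, fun _ s hs => ?_, ?_, rfl⟩⟩
    · obtain ⟨a, -, rfl⟩ := List.mem_map.1 hs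
      exact ⟨a, rfl⟩
    · rw [List.append_assoc]
      exact hr
  · simp [termPrefix] at hr0

theorem StepOf.countP_isLeft {q : G.P × T} {x y : List (G.normalForm.N ⊕ T)}
    (h : G.normalForm.StepOf π (Sum.inr q) x y) :
    x.countP Sum.isLeft = y.countP Sum.isLeft + 1 := by
  obtain ⟨u, v, -, rfl, rfl⟩ := G.normalForm.stepOf_iff.1 h
  simp only [List.countP_append, normalForm, Sum.elim_inr, List.map_cons, List.map_nil,
    List.countP_cons, List.countP_nil, Sum.isLeft_inl, Sum.isLeft_inr]
  simp
  omega

open Classical in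
/-- The number of occurrences of the nonterminal `q` in a sentential form. -/
noncomputable def tagCount (q : G.P × T) (x : List ((G.N ⊕ (G.P × T)) ⊕ T)) : ℕ :=
  x.countP fun s => decide (s = Sum.inl (Sum.inr q))

open Classical in
theorem StepOf.tagCount_eq {p : G.normalForm.P} {q : G.P × T}
    {x y : List (G.normalForm.N ⊕ T)}
    (h : G.normalForm.StepOf π p x y) (hp : p ≠ Sum.inl q.1) :
    tagCount q x = tagCount q y + if p = Sum.inr q then 1 else 0 := by
  obtain ⟨u, v, -, rfl, rfl⟩ := G.normalForm.stepOf_iff.1 h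
  have key : tagCount q ((G.normalForm.lhs p).map Sum.inl) =
      tagCount q (G.normalForm.rhs p) + if p = Sum.inr q then 1 else 0 := by
    rcases p with p | q'
    · have hl : tagCount q ((G.normalForm.lhs (Sum.inl p)).map Sum.inl) = 0 := by
        simp [tagCount, List.countP_eq_zero]
      have hr : tagCount q (G.normalForm.rhs (Sum.inl p)) = 0 := by
        simp only [tagCount, List.countP_eq_zero, decide_eq_true_eq, Sum.elim_inl, List.mem_map]
        rintro _ ⟨A | a, -, rfl⟩ hs
        · simp at hs
        · simp only [Sum.map_inr, Sum.inl.injEq, Sum.inr.injEq] at hs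
          exact hp (by rw [← hs])
      rw [hl, hr, if_neg (by simp)]
    · simp [tagCount, List.countP_cons]
  simp only [tagCount, List.countP_append] at key ⊢
  rw [key]
  omega

section Derivations

variable {s : ℕ → List (G.normalForm.N ⊕ T)} {e : ℕ → G.normalForm.P}

theorem exists_isLeft_of_stepOf
    (hs : ∀ i, G.normalForm.StepOf π (e i) (s i) (s (i + 1))) (n : ℕ) :
    ∃ i, n ≤ i ∧ Sum.isLeft (e i) := by
  by_contra! hcon
  have hdec : ∀ i, n ≤ i → (s i).countP Sum.isLeft = (s (i + 1)).countP Sum.isLeft + 1 := by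
    intro i hi
    have hstep := hs i
    rcases he : e i with p | q
    · exact absurd (by rw [he]; rfl) (hcon i hi)
    · rw [he] at hstep
      exact hstep.countP_isLeft
  obtain ⟨m, hm⟩ := exists_forall_ge_eq_of_eventually_antitone
    (c := fun i => (s i).countP Sum.isLeft) (n := n) fun i hi => by
      have := hdec i hi
      show _ ≤ _
      omega
  have h1 := hm (max n m) (le_max_right _ _)
  have h2 := hdec (max n m) (le_max_left _ _)
  simp only at h1
  omega

/-- A nonterminal `(p, a)` is only rewritten (infinitely often) if `p` is applied (infinitely
often). -/
theorem inl_mem_sigmaSet_of_inr_mem (h0 : s 0 = [Sum.inl G.normalForm.start])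
    (hs : ∀ i, G.normalForm.StepOf π (e i) (s i) (s (i + 1))) (σ : AccSigma) (q : G.P × T)
    (hq : Sum.inr q ∈ sigmaSet σ e) : Sum.inl q.1 ∈ sigmaSet σ e := by
  classical
  by_contra hcon
  have hcount : ∀ i, e i ≠ Sum.inl q.1 → tagCount q (s i) =
      tagCount q (s (i + 1)) + if e i = Sum.inr q then 1 else 0 :=
    fun i hi => (hs i).tagCount_eq hi
  cases σ with
  | ran =>
    have hne : ∀ i, e i ≠ Sum.inl q.1 := fun i hi => hcon ⟨i, hi⟩
    have hzero : ∀ i, tagCount q (s i) = 0 := by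
      intro i
      induction i with
      | zero => simp [h0, tagCount]
      | succ i ih => have := hcount i (hne i); omega
    obtain ⟨i, hi⟩ := hq
    have := hcount i (hne i)
    rw [hzero, if_pos hi] at this
    omega
  | inf =>
    simp only [sigmaSet, Set.mem_ofPred_eq, not_forall, not_exists, not_and] at hcon
    obtain ⟨n, hn⟩ := hcon
    obtain ⟨m, hm⟩ := exists_forall_ge_eq_of_eventually_antitone
      (c := fun i => tagCount q (s i)) (n := n) fun i hi => by
        have := hcount i (hn i hi)
        show _ ≤ _
        omega
    obtain ⟨i, hi, hei⟩ := hq (max n m)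
    have h1 := hm i (le_of_max_le_right hi)
    have h2 := hcount i (hn i (le_of_max_le_left hi))
    rw [if_pos hei] at h2
    omega

theorem isAccepting_normalForm_iff {d : ℕ → G.P} {σ : AccSigma} (ρ : AccRho)
    (hpre : sigmaSet σ d = Sum.inl ⁻¹' sigmaSet σ e)
    (htag : ∀ q, Sum.inr q ∈ sigmaSet σ e → Sum.inl q.1 ∈ sigmaSet σ e) :
    IsAccepting σ ρ G.normalForm.acc e ↔ IsAccepting σ ρ G.acc d := by
  unfold IsAccepting
  rw [hpre]
  constructor
  · rintro ⟨H, ⟨hH, hHt⟩, hr⟩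
    refine ⟨_, hH, ?_⟩
    cases ρ with
    | cap =>
      obtain ⟨p | q, hx, hxH⟩ := hr
      · exact ⟨p, hx, hxH⟩
      · exact ⟨q.1, htag q hx, hHt q hxH⟩
    | sub => exact fun p hp => hr hp
    | eq => exact congrArg _ hr
  · rintro ⟨F, hF, hr⟩
    cases ρ with
    | cap =>
      refine ⟨Sum.inl '' F, ⟨by rwa [Set.preimage_image_eq _ Sum.inl_injective], by simp⟩, ?_⟩
      obtain ⟨p, hp, hpF⟩ := hr
      exact ⟨Sum.inl p, hp, p, hpF, rfl⟩
    | sub =>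
      refine ⟨{x | Sum.elim (· ∈ F) (fun q : G.P × T => q.1 ∈ F) x}, ⟨hF, fun q hq => hq⟩, ?_⟩
      rintro (p | q) hx
      · exact hr hx
      · exact hr (htag q hx)
    | eq =>
      refine ⟨sigmaSet σ e, ⟨?_, htag⟩, rfl⟩
      change Sum.inl ⁻¹' sigmaSet σ e = F at hr
      rwa [hr]

end Derivations

theorem lang_normalForm_subset (σ : AccSigma) (ρ : AccRho) (π : DerivMode) :
    G.normalForm.Lang σ ρ π ⊆ G.Lang σ ρ π := by
  rintro u ⟨s, e, h0, hs, hlen, hmatch, hacc⟩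
  have hinf := exists_isLeft_of_stepOf hs
  let κ : ℕ → ℕ := fun i => Nat.rec 0 (fun j k => k + if Sum.isLeft (e j) then 1 else 0) i
  have hκ : CountsLeft e κ := ⟨rfl, fun _ => rfl⟩
  have hconst : ∀ i j, i ≤ j → κ i = κ j → (s j).map G.erase = (s i).map G.erase := by
    intro i j hij
    induction j, hij using Nat.le_induction with
    | base => simp
    | succ j hij ih =>
      intro hk
      have h1 := hκ.monotone hij
      have h2 := hκ.2 j
      have hstep := hs j
      rcases he : e j with p | q
      · rw [he] at h2
        simp at h2
        omega
      · rw [he] at h2 hstep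
        simp at h2
        rw [hstep.map_erase_of_inr, ih (by omega)]
  have hconst' : ∀ i j, κ i = κ j → (s i).map G.erase = (s j).map G.erase := by
    intro i j hij
    rcases le_total i j with h | h
    · exact (hconst i j h hij).symm
    · exact hconst j i h hij.symm
  choose idx hidx hleft using hκ.exists_isLeft_eq hinf
  choose d hd using fun m => Sum.isLeft_iff.1 (hleft m)
  have hdκ : ∀ i p, e i = Sum.inl p → d (κ i) = p := by
    intro i p hi
    have hii : idx (κ i) = i := hκ.eq_of_isLeft (hleft _) (by simp [hi]) (hidx _)
    have := hd (κ i)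
    rw [hii, hi] at this
    exact (Sum.inl_injective this).symm
  have herase : ∀ i, (s (idx (κ i))).map G.erase = (s i).map G.erase :=
    fun i => hconst' _ _ (hidx _)
  have hmono : ∀ i j, i ≤ j →
      termPrefix ((s i).map G.erase) <+: termPrefix ((s j).map G.erase) := by
    intro i j hij
    induction j, hij using Nat.le_induction with
    | base => exact List.prefix_rfl
    | succ j hij ih =>
      refine ih.trans ?_
      have hstep := hs j
      rcases he : e j with p | q
      · rw [he] at hstep
        exact hstep.map_erase_of_inl.termPrefix_prefix
      · rw [he] at hstep
        rw [hstep.map_erase_of_inr]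
  refine ⟨fun m => (s (idx m)).map G.erase, d, ?_, fun m => ?_, fun n => ?_, fun m => ?_, ?_⟩
  · have := herase 0
    rw [h0] at this
    exact this
  · have hstep := hs (idx m)
    rw [hd m] at hstep
    have hk : κ (idx m + 1) = m + 1 := by rw [hκ.succ_of_isLeft (hleft m), hidx]
    have := herase (idx m + 1)
    rw [hk] at this
    simp only
    rw [this]
    exact hstep.map_erase_of_inl
  · obtain ⟨i, hi⟩ := hlen n
    refine ⟨κ i, hi.trans ?_⟩
    simp only
    rw [herase]
    exact (G.termPrefix_prefix_map_erase (s i)).length_le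
  · obtain ⟨j, hj⟩ := hlen (termPrefix ((s (idx m)).map G.erase)).length
    have h1 := hmono (idx m) (max (idx m) j) (le_max_left _ _)
    have h2 : termPrefix (s j) <+: termPrefix ((s (max (idx m) j)).map G.erase) :=
      (G.termPrefix_prefix_map_erase (s j)).trans (hmono j _ (le_max_right _ _))
    exact (hmatch j).of_prefix (List.prefix_of_prefix_length_le h1 h2 hj)
  · exact (isAccepting_normalForm_iff ρ (hκ.sigmaSet_eq_preimage hinf hdκ σ)
      (inl_mem_sigmaSet_of_inr_mem h0 hs σ)).1 hacc

theorem lang_subset_normalForm (σ : AccSigma) (ρ : AccRho) (π : DerivMode) :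
    G.Lang σ ρ π ⊆ G.normalForm.Lang σ ρ π := by
  rintro u ⟨s, d, h0, hs, hlen, hmatch, hacc⟩
  let State := {c : ℕ × List (G.normalForm.N ⊕ T) // c.2.map G.erase = s c.1}
  have hnext : ∀ c : State, ∃ (p : G.normalForm.P) (c' : State),
      G.normalForm.StepOf π p c.1.2 c'.1.2 ∧
      c'.1.1 = c.1.1 + (if Sum.isLeft p then 1 else 0) ∧
      ∀ p', p = Sum.inl p' → d c.1.1 = p' ∧ termPrefix c.1.2 = termPrefix (s c.1.1) := by
    rintro ⟨⟨k, x⟩, hx : x.map G.erase = s k⟩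
    by_cases ht : termPrefix x = termPrefix (x.map G.erase)
    · have hstep := hs k
      rw [← hx] at hstep
      obtain ⟨y, hy, hye⟩ := hstep.exists_lift ht
      refine ⟨Sum.inl (d k), ⟨(k + 1, y), hye⟩, hy, rfl, fun p' hp' => ?_⟩
      exact ⟨Sum.inl_injective hp', by rw [ht, hx]⟩
    · obtain ⟨q, y, hy⟩ := exists_stepOf_inr ht π
      exact ⟨Sum.inr q, ⟨(k, y), hy.map_erase_of_inr.trans hx⟩, hy, rfl,
        fun p' hp' => by cases hp'⟩
  choose lab next hstep hcount hleft using hnext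
  let c₀ : State := ⟨(0, [Sum.inl G.normalForm.start]), by rw [h0]; rfl⟩
  let c : ℕ → State := fun i => Nat.rec c₀ (fun _ => next) i
  let e : ℕ → G.normalForm.P := fun i => lab (c i)
  let κ : ℕ → ℕ := fun i => (c i).1.1
  have hsteps : ∀ i, G.normalForm.StepOf π (e i) (c i).1.2 (c (i + 1)).1.2 :=
    fun i => hstep (c i)
  have hinf := exists_isLeft_of_stepOf hsteps
  have hκ : CountsLeft e κ := ⟨rfl, fun i => hcount (c i)⟩
  refine ⟨fun i => (c i).1.2, e, rfl, hsteps, fun n => ?_, fun i => ?_, ?_⟩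
  · obtain ⟨k, hk⟩ := hlen n
    obtain ⟨i, rfl, hi⟩ := hκ.exists_isLeft_eq hinf k
    obtain ⟨p, hp⟩ := Sum.isLeft_iff.1 hi
    exact ⟨i, hk.trans_eq (congrArg List.length (hleft (c i) p hp).2.symm)⟩
  · refine (hmatch (κ i)).of_prefix ?_
    have := G.termPrefix_prefix_map_erase (c i).1.2
    rwa [(c i).2] at this
  · exact (isAccepting_normalForm_iff ρ
      (hκ.sigmaSet_eq_preimage hinf (fun i p hp => (hleft (c i) p hp).1) σ)
      (inl_mem_sigmaSet_of_inr_mem rfl hsteps σ)).2 hacc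

end OmegaPSG

end OmegaFormal

/-- Lemma: every ω-CSG G has a (σ,ρ,π)-equivalent (for all modes) ω-CSG G'
whose productions are of the forms α → β (α,β ∈ N⁺, |α| ≤ |β|) or A → a. -/
theorem csg_normal_form (T : Type) [Fintype T] (G : OmegaPSG T) (hG : G.IsCSG) :
    ∃ G' : OmegaPSG T, G'.IsCSG ∧
      (∀ p : G'.P,
        (∃ β : List G'.N, β ≠ [] ∧ (G'.lhs p).length ≤ β.length ∧
          G'.rhs p = β.map Sum.inl) ∨
        ((G'.lhs p).length = 1 ∧ ∃ a : T, G'.rhs p = [Sum.inr a])) ∧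
      ∀ (σ : AccSigma) (ρ : AccRho) (π : DerivMode),
        G.Lang σ ρ π = G'.Lang σ ρ π := by
  exact ⟨G.normalForm, G.isCSG_normalForm hG, G.normalForm_form hG, fun σ ρ π =>
    (OmegaPSG.lang_subset_normalForm σ ρ π).antisymm (OmegaPSG.lang_normalForm_subset σ ρ π)⟩
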